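/- For all r ∈ (0,1), (2/π) E(r) < (875/872) S_{5/2,2}(1, √(1−r²)) − (3/872)(1 − r²/4 − 3r⁴/64 − 5r⁶/256), where E is the complete elliptic integral of the second kind and S_{5/2,2}(1,x) = ((4/5)(1−x^{5/2})/(1−x²))². -/

import Mathlib

open Real

/-- Complete elliptic integral of the second kind. -/
noncomputable def ellipticE (r : ℝ) : ℝ :=
  ∫ t in (0:ℝ)..(π / 2), Real.sqrt (1 - r ^ 2 * Real.sin t ^ 2)

/-- The Stolarsky mean `S_{5/2,2}(1,x)`. -/
noncomputable def S52 (x : ℝ) : ℝ := (4 / 5 * (1 - x ^ ((5:ℝ) / 2)) / (1 - x ^ 2)) ^ 2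

/-- The coefficient of `x ^ n` in the expansion of `(1 - x) ^ a`. -/
noncomputable def oneSubCoeff (a : ℝ) : ℕ → ℝ
  | 0 => 1
  | n + 1 => oneSubCoeff a n * ((n - a) / (n + 1))

theorem oneSubCoeff_eq_choose (a : ℝ) (n : ℕ) :
    oneSubCoeff a n = (-1) ^ n * Ring.choose a n := by
  induction n with
  | zero => simp [oneSubCoeff]
  | succ n ih =>
    rw [oneSubCoeff, ih, Ring.choose_eq_smul, Ring.choose_eq_smul, descPochhammer_succ_right,
      Polynomial.smeval_mul, Nat.factorial_succ]
    have := Nat.factorial_ne_zero n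
    simp only [Polynomial.smeval_sub, Polynomial.smeval_X, Polynomial.smeval_natCast, smul_eq_mul]
    push_cast
    field_simp
    simp
    ring

theorem hasSum_oneSubCoeff (a : ℝ) {x : ℝ} (h0 : 0 ≤ x) (h1 : x < 1) :
    HasSum (fun n => oneSubCoeff a n * x ^ n) ((1 - x) ^ a) := by
  have h := (Real.one_add_rpow_hasFPowerSeriesOnBall_zero (a := a)).hasSum (y := -x) (by
    rw [← ENNReal.ofReal_one, Metric.eball_ofReal]
    simpa [abs_of_nonneg h0] using h1)
  convert! h using 1
  · funext n
    rw [binomialSeries_apply, oneSubCoeff_eq_choose, List.prod_ofFn]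
    simp only [Finset.prod_const, Finset.card_univ, Fintype.card_fin, smul_eq_mul]
    rw [neg_pow x]
    ring
  · simp [sub_eq_add_neg]

theorem integral_sin_pow_even_half (n : ℕ) :
    ∫ t in (0:ℝ)..(π / 2), sin t ^ (2 * n) = π / 2 * oneSubCoeff (-1 / 2) n := by
  induction n with
  | zero => simp [oneSubCoeff]
  | succ n ih =>
    rw [show 2 * (n + 1) = 2 * n + 2 by ring, integral_sin_pow, ih, oneSubCoeff]
    push_cast
    simp
    field_simp
    ring

theorem hasSum_ellipticE {r : ℝ} (h1 : r ^ 2 < 1) :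
    HasSum (fun n => oneSubCoeff (1 / 2) n * oneSubCoeff (-1 / 2) n * (r ^ 2) ^ n)
      (2 / π * ellipticE r) := by
  have h0 : 0 ≤ r ^ 2 := sq_nonneg r
  let f : ℕ → C(ℝ, ℝ) := fun n =>
    ⟨fun t => oneSubCoeff (1 / 2) n * (r ^ 2 * sin t ^ 2) ^ n, by fun_prop⟩
  have hf : Summable fun n => ‖(f n).restrict
      (⟨Set.uIcc 0 (π / 2), isCompact_uIcc⟩ : TopologicalSpace.Compacts ℝ)‖ := by
    refine Summable.of_nonneg_of_le (fun n => norm_nonneg _) (fun n => ?_)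
      (hasSum_oneSubCoeff (1 / 2) h0 h1).summable.abs
    rw [ContinuousMap.norm_le _ (abs_nonneg _)]
    rintro ⟨t, -⟩
    change ‖oneSubCoeff (1 / 2) n * (r ^ 2 * sin t ^ 2) ^ n‖ ≤ _
    rw [Real.norm_eq_abs, abs_mul, abs_mul]
    refine mul_le_mul_of_nonneg_left ?_ (abs_nonneg _)
    rw [abs_of_nonneg (by positivity), abs_of_nonneg (by positivity)]
    exact pow_le_pow_left₀ (by positivity)
      (mul_le_of_le_one_right h0 (sin_sq_le_one t)) n
  have h := (intervalIntegral.hasSum_intervalIntegral_of_summable_norm hf).mul_left (2 / π)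
  convert! h using 1
  · funext n
    have : ∀ t, f n t = oneSubCoeff (1 / 2) n * (r ^ 2) ^ n * sin t ^ (2 * n) := fun t => by
      change oneSubCoeff (1 / 2) n * (r ^ 2 * sin t ^ 2) ^ n = _
      rw [mul_pow, ← pow_mul (sin t)]
      ring
    simp only [this, intervalIntegral.integral_const_mul, integral_sin_pow_even_half]
    field_simp
  · congr 1
    refine intervalIntegral.integral_congr fun t _ => ?_
    have hs := sin_sq_le_one t
    have := hasSum_oneSubCoeff (1 / 2) (x := r ^ 2 * sin t ^ 2) (by positivity)
      (by nlinarith [sq_nonneg (sin t)])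
    rw [← sqrt_eq_rpow] at this
    exact this.tsum_eq.symm

theorem S52_sqrt_one_sub {m : ℝ} (h0 : 0 < m) (h1 : m < 1) :
    S52 (√(1 - m)) =
      16 / 25 * (1 - 2 * (1 - m) ^ (5 / 4 : ℝ) + (1 - m) ^ (5 / 2 : ℝ)) / m ^ 2 := by
  have h : 0 ≤ 1 - m := by linarith
  have e1 : √(1 - m) ^ (5 / 2 : ℝ) = (1 - m) ^ (5 / 4 : ℝ) := by
    rw [sqrt_eq_rpow, ← rpow_mul h]
    norm_num
  have e2 : (1 - m) ^ (5 / 2 : ℝ) = ((1 - m) ^ (5 / 4 : ℝ)) ^ 2 := by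
    rw [← rpow_natCast, ← rpow_mul h]
    norm_num
  rw [S52, e1, e2, sq_sqrt h, sub_sub_cancel]
  generalize (1 - m) ^ (5 / 4 : ℝ) = y
  field_simp
  ring

theorem hasSum_S52 {m : ℝ} (h0 : 0 < m) (h1 : m < 1) :
    HasSum (fun n => 16 / 25 *
      (oneSubCoeff (5 / 2) (n + 2) - 2 * oneSubCoeff (5 / 4) (n + 2)) * m ^ n)
      (S52 (√(1 - m))) := by
  have h := (hasSum_oneSubCoeff (5 / 2) h0.le h1).sub
    ((hasSum_oneSubCoeff (5 / 4) h0.le h1).mul_left 2)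
  rw [← hasSum_nat_add_iff' 2] at h
  convert! h.mul_left (16 / 25 / m ^ 2) using 1
  · funext n
    field_simp
    ring
  · rw [S52_sqrt_one_sub h0 h1]
    simp only [Finset.sum_range_succ, Finset.sum_range_zero, oneSubCoeff]
    norm_num
    ring

theorem oneSubCoeff_nonneg_step {a : ℝ} {n : ℕ} (han : a ≤ n) (h : 0 ≤ oneSubCoeff a n) :
    0 ≤ oneSubCoeff a (n + 1) :=
  mul_nonneg h (div_nonneg (by linarith) (by positivity))

theorem oneSubCoeff_nonpos_step {a : ℝ} {n : ℕ} (han : a ≤ n) (h : oneSubCoeff a n ≤ 0) :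
    oneSubCoeff a (n + 1) ≤ 0 :=
  mul_nonpos_of_nonpos_of_nonneg h (div_nonneg (by linarith) (by positivity))

theorem oneSubCoeff_five_fourths_nonneg (n : ℕ) : 0 ≤ oneSubCoeff (5 / 4) (n + 2) := by
  induction n with
  | zero => norm_num [oneSubCoeff]
  | succ n ih => exact oneSubCoeff_nonneg_step (by push_cast; linarith [n.cast_nonneg (α := ℝ)]) ih

theorem oneSubCoeff_five_halves_nonpos (n : ℕ) : oneSubCoeff (5 / 2) (n + 3) ≤ 0 := by
  induction n with
  | zero => norm_num [oneSubCoeff]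
  | succ n ih => exact oneSubCoeff_nonpos_step (by push_cast; linarith [n.cast_nonneg (α := ℝ)]) ih

theorem oneSubCoeff_half_nonpos (n : ℕ) : oneSubCoeff (1 / 2) (n + 1) ≤ 0 := by
  induction n with
  | zero => norm_num [oneSubCoeff]
  | succ n ih => exact oneSubCoeff_nonpos_step (by push_cast; linarith [n.cast_nonneg (α := ℝ)]) ih

theorem oneSubCoeff_neg_half_nonneg (n : ℕ) : 0 ≤ oneSubCoeff (-1 / 2) n := by
  induction n with
  | zero => norm_num [oneSubCoeff]
  | succ n ih => exact oneSubCoeff_nonneg_step (by linarith [n.cast_nonneg (α := ℝ)]) ih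

/-- The coefficient of `r ^ (2 * n)` in `875 / 872 * S52 (√(1 - r ^ 2)) - 2 / π * ellipticE r`. -/
noncomputable def gapCoeff (n : ℕ) : ℝ :=
  875 / 872 * (16 / 25 * (oneSubCoeff (5 / 2) (n + 2) - 2 * oneSubCoeff (5 / 4) (n + 2))) -
    oneSubCoeff (1 / 2) n * oneSubCoeff (-1 / 2) n

theorem gapCoeff_succ_nonneg {n : ℕ} (hn : 12 ≤ n) (h : 0 ≤ gapCoeff n) :
    0 ≤ gapCoeff (n + 1) := by
  have hn' : (12 : ℝ) ≤ n := by exact_mod_cast hn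
  obtain ⟨k, rfl⟩ : ∃ k, n = k + 1 := ⟨n - 1, by omega⟩
  have hb := oneSubCoeff_five_fourths_nonneg (k + 1)
  have hc := oneSubCoeff_five_halves_nonpos k
  have hp := mul_nonpos_of_nonpos_of_nonneg (oneSubCoeff_half_nonpos k)
    (oneSubCoeff_neg_half_nonneg (k + 1))
  rw [show k + 3 = k + 1 + 2 by ring] at hc
  generalize k + 1 = n at *
  have hb' : oneSubCoeff (5 / 4) (n + 1 + 2) =
      oneSubCoeff (5 / 4) (n + 2) * ((n + 3 / 4) / (n + 3)) := by
    rw [show n + 1 + 2 = n + 2 + 1 by ring, oneSubCoeff]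
    push_cast
    ring
  have hc' : oneSubCoeff (5 / 2) (n + 1 + 2) =
      oneSubCoeff (5 / 2) (n + 2) * ((n + 3 / 4) / (n + 3)) -
        oneSubCoeff (5 / 2) (n + 2) * (5 / 4 / (n + 3)) := by
    rw [show n + 1 + 2 = n + 2 + 1 by ring, oneSubCoeff]
    push_cast
    ring
  have hp' : oneSubCoeff (1 / 2) (n + 1) * oneSubCoeff (-1 / 2) (n + 1) =
      oneSubCoeff (1 / 2) n * oneSubCoeff (-1 / 2) n *
        ((n - 1 / 2) * (n + 1 / 2) / (n + 1) ^ 2) := by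
    rw [oneSubCoeff, oneSubCoeff]
    field_simp
    ring
  have hρ : (0 : ℝ) ≤ (n + 3 / 4) / (n + 3) := by positivity
  have hle : ((n : ℝ) + 3 / 4) / (n + 3) ≤ (n - 1 / 2) * (n + 1 / 2) / (n + 1) ^ 2 := by
    rw [div_le_div_iff₀ (by positivity) (by positivity)]
    nlinarith
  have h1 := mul_le_mul_of_nonpos_left hle hp
  have h2 := mul_nonneg h hρ
  have h3 : oneSubCoeff (5 / 2) (n + 2) * (5 / 4 / (n + 3)) ≤ 0 :=
    mul_nonpos_of_nonpos_of_nonneg hc (by positivity)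
  unfold gapCoeff at h2 ⊢
  rw [hb', hc', hp']
  nlinarith

theorem gapCoeff_nonneg (n : ℕ) : 0 ≤ gapCoeff (n + 4) := by
  induction n with
  | zero => norm_num [gapCoeff, oneSubCoeff]
  | succ n ih =>
    rcases lt_or_ge n 8 with hn | hn
    · interval_cases n <;> norm_num [gapCoeff, oneSubCoeff]
    · exact gapCoeff_succ_nonneg (n := n + 4) (by omega) ih

theorem ellipticE_upper_bound_S52 (r : ℝ) (hr : r ∈ Set.Ioo (0:ℝ) 1) :
    2 / π * ellipticE r <
      875 / 872 * S52 (Real.sqrt (1 - r ^ 2)) -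
        3 / 872 * (1 - r ^ 2 / 4 - 3 * r ^ 4 / 64 - 5 * r ^ 6 / 256) := by
  obtain ⟨hr0, hr1⟩ := hr
  have h0 : 0 < r ^ 2 := by positivity
  have h1 : r ^ 2 < 1 := by nlinarith
  have h : HasSum (fun n => gapCoeff n * (r ^ 2) ^ n)
      (875 / 872 * S52 (√(1 - r ^ 2)) - 2 / π * ellipticE r) := by
    convert! ((hasSum_S52 h0 h1).mul_left (875 / 872)).sub (hasSum_ellipticE h1) using 1
    funext n
    rw [gapCoeff]
    ring
  rw [← hasSum_nat_add_iff' 4] at h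
  have hpos := hasSum_lt (i := 1) (fun n => mul_nonneg (gapCoeff_nonneg n) (by positivity))
    (mul_pos (by norm_num [gapCoeff, oneSubCoeff]) (by positivity)) hasSum_zero h
  simp only [Finset.sum_range_succ, Finset.sum_range_zero, gapCoeff, oneSubCoeff] at hpos
  norm_num at hpos
  linarith
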